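/- arXiv:1101.5790 — 2 statements merged into one kernel-verified Lean document; each statement's English description precedes it below -/
import Mathlib

section
/- Let H ∈ (1/2,1) and α ∈ (0, 1−H). Then ∫₁^∞ ∫₁^∞ s^(α−1) u^(α−1) |s−u|^(2H−2) du ds = β(2−α−2H, 2H−1)/(1−H−α), where β denotes the Beta function β(a,b) = ∫₀¹ x^(a−1)(1−x)^(b−1) dx. -/
open MeasureTheory Set

lemma integrableOn_rpow_mul_one_sub_rpow {p q : ℝ} (hp : 0 < p) (hq : 0 < q) :
    IntegrableOn (fun x : ℝ => x ^ (p - 1) * (1 - x) ^ (q - 1)) (Ioo 0 1) := by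
  have h := Complex.betaIntegral_convergent (u := p) (v := q) (by simpa) (by simpa)
  rw [intervalIntegrable_iff_integrableOn_Ioo_of_le zero_le_one] at h
  refine IntegrableOn.congr_fun h.re (fun x hx => ?_) measurableSet_Ioo
  have h1 : ((x : ℂ) ^ ((p : ℂ) - 1)) = ((x ^ (p - 1) : ℝ) : ℂ) := by
    rw [Complex.ofReal_cpow hx.1.le]; push_cast; rfl
  have h2 : ((1 - (x : ℂ)) ^ ((q : ℂ) - 1)) = (((1 - x) ^ (q - 1) : ℝ) : ℂ) := by
    rw [Complex.ofReal_cpow (sub_nonneg.2 hx.2.le)]; push_cast; rfl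
  simp only [h1, h2, ← Complex.ofReal_mul, RCLike.re_to_complex, Complex.ofReal_re]

lemma image_div_Ioo_zero_one {s : ℝ} (hs : 0 < s) :
    (fun x : ℝ => s / x) '' Ioo 0 1 = Ioi s := by
  ext u
  constructor
  · rintro ⟨x, hx, rfl⟩
    exact (lt_div_iff₀ hx.1).2 (mul_lt_of_lt_one_right hs hx.2)
  · intro hu
    have hu0 : 0 < u := hs.trans hu
    exact ⟨s / u, ⟨div_pos hs hu0, (div_lt_one hu0).2 hu⟩, div_div_cancel₀ hs.ne'⟩

lemma hasDerivWithinAt_const_div {s x : ℝ} (hx : x ∈ Ioo (0 : ℝ) 1) :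
    HasDerivWithinAt (fun x : ℝ => s / x) (-s / x ^ 2) (Ioo 0 1) x := by
  have h := ((hasDerivAt_inv hx.1.ne').const_mul s).hasDerivWithinAt (s := Ioo 0 1)
  simpa only [div_eq_mul_inv, mul_neg, neg_mul, one_mul] using h

lemma injOn_const_div {s : ℝ} (hs : 0 < s) : InjOn (fun x : ℝ => s / x) (Ioo 0 1) := by
  intro x _ y _ h
  exact inv_injective (mul_left_cancel₀ hs.ne' (by simpa only [div_eq_mul_inv] using h))

lemma abs_deriv_mul_kernel {a b s x : ℝ} (hs : 0 < s) (hx : x ∈ Ioo (0 : ℝ) 1) :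
    |-s / x ^ 2| • (s ^ a * (s / x) ^ a * |s - s / x| ^ b)
      = s ^ (2 * a + b + 1) * (x ^ ((-a - b - 1) - 1) * (1 - x) ^ ((b + 1) - 1)) := by
  obtain ⟨h0, h1⟩ := hx
  have h1' : 0 < 1 - x := sub_pos.2 h1
  have e1 : |-s / x ^ 2| = s / x ^ 2 := by
    rw [neg_div, abs_neg, abs_of_pos (by positivity)]
  have e2 : |s - s / x| = s * (1 - x) / x := by
    rw [show s - s / x = -(s * (1 - x) / x) by field_simp; ring, abs_neg,
      abs_of_pos (by positivity)]
  have e3 : s ^ (2 * a + b + 1) = s ^ a * s ^ a * s ^ b * s := by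
    rw [Real.rpow_add_one hs.ne', Real.rpow_add hs, two_mul, Real.rpow_add hs]
  have e4 : x ^ ((-a - b - 1) - 1) = (x ^ a)⁻¹ * (x ^ b)⁻¹ * (x ^ 2)⁻¹ := by
    rw [show (-a - b - 1) - 1 = -a + -b + -(2 : ℕ) by push_cast; ring, Real.rpow_add h0,
      Real.rpow_add h0, Real.rpow_neg h0.le, Real.rpow_neg h0.le, Real.rpow_neg h0.le,
      Real.rpow_natCast]
  rw [e1, e2, e3, e4, Real.div_rpow hs.le h0.le, Real.div_rpow (by positivity) h0.le,
    Real.mul_rpow hs.le h1'.le, add_sub_cancel_right, smul_eq_mul]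
  simp only [div_eq_mul_inv]
  ring

lemma integrableOn_kernel_Ioi {a b s : ℝ} (hs : 0 < s) (hp : 0 < -a - b - 1) (hq : 0 < b + 1) :
    IntegrableOn (fun u : ℝ => s ^ a * u ^ a * |s - u| ^ b) (Ioi s) := by
  rw [← image_div_Ioo_zero_one hs, integrableOn_image_iff_integrableOn_abs_deriv_smul
    measurableSet_Ioo (fun x hx => hasDerivWithinAt_const_div hx) (injOn_const_div hs)]
  exact IntegrableOn.congr_fun ((integrableOn_rpow_mul_one_sub_rpow hp hq).const_mul _)
    (fun x hx => (abs_deriv_mul_kernel hs hx).symm) measurableSet_Ioo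

lemma integral_kernel_Ioi {a b s : ℝ} (hs : 0 < s) :
    ∫ u in Ioi s, s ^ a * u ^ a * |s - u| ^ b
      = s ^ (2 * a + b + 1) *
        ∫ x in Ioo (0 : ℝ) 1, x ^ ((-a - b - 1) - 1) * (1 - x) ^ ((b + 1) - 1) := by
  rw [← image_div_Ioo_zero_one hs, integral_image_eq_integral_abs_deriv_smul
    measurableSet_Ioo (fun x hx => hasDerivWithinAt_const_div hx) (injOn_const_div hs),
    ← integral_const_mul]
  exact setIntegral_congr_fun measurableSet_Ioo fun x hx => abs_deriv_mul_kernel hs hx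

lemma integral_integral_kernel {a b : ℝ} (hb : b ≠ 0) (hp : 0 < -a - b - 1) (hq : 0 < b + 1)
    (hab : 2 * a + b + 1 < -1) :
    ∫ s in Ioi (1 : ℝ), ∫ u in Ioi (1 : ℝ), s ^ a * u ^ a * |s - u| ^ b
      = 2 * ((∫ s in Ioi (1 : ℝ), s ^ (2 * a + b + 1)) *
        ∫ x in Ioo (0 : ℝ) 1, x ^ ((-a - b - 1) - 1) * (1 - x) ^ ((b + 1) - 1)) := by
  set B := ∫ x in Ioo (0 : ℝ) 1, x ^ ((-a - b - 1) - 1) * (1 - x) ^ ((b + 1) - 1)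
  set μ := (volume : Measure ℝ).restrict (Ioi 1)
  let K : ℝ × ℝ → ℝ := fun z => z.1 ^ a * z.2 ^ a * |z.1 - z.2| ^ b
  let F : ℝ × ℝ → ℝ := {z : ℝ × ℝ | z.1 < z.2}.indicator K
  have hFmeas : Measurable F :=
    (by fun_prop : Measurable K).indicator (measurableSet_lt measurable_fst measurable_snd)
  have hslice (s : ℝ) : (fun u => F (s, u)) = (Ioi s).indicator (fun u => K (s, u)) := rfl
  have hμ {s : ℝ} (hs : 1 < s) : μ.restrict (Ioi s) = volume.restrict (Ioi s) := by
    rw [Measure.restrict_restrict measurableSet_Ioi,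
      inter_eq_left.2 (Ioi_subset_Ioi hs.le)]
  have hint {s : ℝ} (hs : 1 < s) : Integrable (fun u => F (s, u)) μ := by
    rw [hslice, integrable_indicator_iff measurableSet_Ioi, IntegrableOn, hμ hs]
    exact integrableOn_kernel_Ioi (one_pos.trans hs) hp hq
  have hval {s : ℝ} (hs : 1 < s) : ∫ u, F (s, u) ∂μ = s ^ (2 * a + b + 1) * B := by
    rw [hslice, integral_indicator measurableSet_Ioi, hμ hs]
    exact integral_kernel_Ioi (one_pos.trans hs)
  have hnorm {s : ℝ} (hs : 1 < s) : ∫ u, ‖F (s, u)‖ ∂μ = s ^ (2 * a + b + 1) * B := by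
    rw [← hval hs]
    refine setIntegral_congr_fun measurableSet_Ioi fun u hu => ?_
    have hu : 0 < u := one_pos.trans hu
    have hs0 : 0 < s := one_pos.trans hs
    exact Real.norm_of_nonneg (indicator_apply_nonneg fun _ => by dsimp only [K]; positivity)
  have hF : Integrable F (μ.prod μ) := by
    rw [integrable_prod_iff hFmeas.aestronglyMeasurable]
    refine ⟨ae_restrict_of_forall_mem measurableSet_Ioi fun s hs => hint hs, ?_⟩
    exact IntegrableOn.congr_fun ((integrableOn_Ioi_rpow_of_lt hab one_pos).mul_const B)
      (fun s hs => (hnorm hs).symm) measurableSet_Ioi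
  have hFval : ∫ z, F z ∂μ.prod μ = (∫ s in Ioi (1 : ℝ), s ^ (2 * a + b + 1)) * B := by
    rw [integral_prod _ hF, ← integral_mul_const]
    exact setIntegral_congr_fun measurableSet_Ioi fun s hs => hval hs
  have hsplit (s u : ℝ) : s ^ a * u ^ a * |s - u| ^ b = F (s, u) + F (u, s) := by
    rcases lt_trichotomy s u with h | rfl | h
    · simp [F, K, h, h.not_gt]
    · simp [F, Real.zero_rpow hb]
    · simp only [F, K, indicator, mem_ofPred_eq, h, h.not_gt, if_true, if_false, zero_add]
      rw [abs_sub_comm, mul_comm (s ^ a)]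
  have hG : Integrable (fun z : ℝ × ℝ => F z + F z.swap) (μ.prod μ) := hF.add hF.swap
  calc _ = ∫ s, ∫ u, (F (s, u) + F (s, u).swap) ∂μ ∂μ := by simp_rw [hsplit]; rfl
    _ = ∫ z, (F z + F z.swap) ∂μ.prod μ := (integral_prod _ hG).symm
    _ = _ := by
      have h := integral_add hF hF.swap
      simp only [Function.comp_apply] at h
      rw [h, integral_prod_swap, hFval]
      ring

theorem stmt9 (H α : ℝ) (hH : 1/2 < H) (hH1 : H < 1)
    (hα : α ∈ Set.Ioo (0:ℝ) (1 - H)) :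
    (∫ s in Set.Ioi (1:ℝ), ∫ u in Set.Ioi (1:ℝ),
      s ^ (α - 1) * u ^ (α - 1) * |s - u| ^ (2*H - 2))
    = (∫ x in Set.Ioo (0:ℝ) 1,
        x ^ (2 - α - 2*H - 1) * (1 - x) ^ (2*H - 1 - 1)) / (1 - H - α) := by
  obtain ⟨_, h1⟩ := hα
  have hab : 2 * (α - 1) + (2 * H - 2) + 1 < -1 := by linarith
  have hne : 1 - H - α ≠ 0 := by linarith
  rw [integral_integral_kernel (by linarith) (by linarith) (by linarith) hab,
    integral_Ioi_rpow_of_lt hab one_pos, Real.one_rpow,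
    show -(α - 1) - (2 * H - 2) - 1 = 2 - α - 2 * H by ring,
    show 2 * H - 2 + 1 = 2 * H - 1 by ring,
    show 2 * (α - 1) + (2 * H - 2) + 1 + 1 = -(2 * (1 - H - α)) by ring]
  field_simp
end

section
/- Let H ∈ (1/2,1) and T ∈ (0,1]. Then (1/|log(T−t)|) ∫₀ᵗ ∫₀ᵗ (T−s)^(−H)(T−u)^(−H) |s−u|^(2H−2) du ds → 2 β(1−H, 2H−1) as t → T⁻. -/
open MeasureTheory Set Filter

/-- The substitution `s = T - exp w` turns a logarithmic weight into Lebesgue measure. -/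
lemma integral_inv_mul_intervalIntegral_div {κ : ℝ → ℝ} (hκ : Integrable κ) {t T : ℝ}
    (ht : 0 < t) (htT : t < T) :
    ∫ s in (0 : ℝ)..t, (T - s)⁻¹ * ∫ x in ((T - t) / (T - s))..(T / (T - s)), κ x =
      ∫ w in (Real.log (T - t))..(Real.log T),
        ∫ x in ((T - t) * Real.exp (-w))..(T * Real.exp (-w)), κ x := by
  have hP : Continuous fun y => ∫ x in (0 : ℝ)..y, κ x :=
    intervalIntegral.continuous_primitive (fun _ _ => hκ.intervalIntegrable) 0
  set G : ℝ → ℝ := fun w => ∫ x in ((T - t) * Real.exp (-w))..(T * Real.exp (-w)), κ x with hG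
  have hGc : Continuous G := by
    have : G = fun w => (∫ x in (0 : ℝ)..(T * Real.exp (-w)), κ x) -
        ∫ x in (0 : ℝ)..((T - t) * Real.exp (-w)), κ x := by
      funext w
      exact (intervalIntegral.integral_interval_sub_left hκ.intervalIntegrable
        hκ.intervalIntegrable).symm
    rw [this]
    exact (hP.comp (by fun_prop)).sub (hP.comp (by fun_prop))
  have hε : 0 < T - t := by linarith
  have hpos : ∀ a ∈ uIcc (T - t) T, 0 < a := by
    intro a ha
    rw [uIcc_of_le (by linarith)] at ha
    linarith [ha.1]
  have h := intervalIntegral.integral_comp_mul_deriv (a := T - t) (b := T) (f := Real.log)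
    (f' := fun a => a⁻¹) (g := G) (fun a ha => Real.hasDerivAt_log (hpos a ha).ne')
    (continuousOn_id.inv₀ fun a ha => (hpos a ha).ne') hGc
  rw [← h]
  have h2 := intervalIntegral.integral_comp_sub_left (a := 0) (b := t)
    (fun a => a⁻¹ * ∫ x in ((T - t) / a)..(T / a), κ x) T
  simp only [sub_zero] at h2
  rw [h2]
  refine intervalIntegral.integral_congr fun a ha => ?_
  have ha' := hpos a ha
  simp only [hG, Function.comp, Real.exp_neg, Real.exp_log ha', div_eq_mul_inv]
  ring

lemma tendsto_inv_abs_log_mul_integral {κ : ℝ → ℝ} (hκ : Integrable κ) {T : ℝ}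
    (hT : 0 < T) :
    Tendsto (fun t : ℝ => (1 / |Real.log (T - t)|) *
      ∫ s in (0 : ℝ)..t, (T - s)⁻¹ * ∫ x in ((T - t) / (T - s))..(T / (T - s)), κ x)
      (nhdsWithin T (Iio T)) (nhds (∫ x in Ioi 0, κ x)) := by
  have hP : Continuous fun y => ∫ x in (0 : ℝ)..y, κ x :=
    intervalIntegral.continuous_primitive (fun _ _ => hκ.intervalIntegrable) 0
  set M := ∫ x, ‖κ x‖
  have hM : ∀ a b : ℝ, ‖∫ x in a..b, κ x‖ ≤ M := fun a b =>
    intervalIntegral.norm_integral_le_integral_norm_uIoc.trans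
      (setIntegral_le_integral hκ.norm (Eventually.of_forall fun _ => norm_nonneg _))
  have hlog : Tendsto (fun t : ℝ => Real.log (T - t)) (nhdsWithin T (Iio T)) atBot := by
    refine Real.tendsto_log_nhdsGT_zero.comp (tendsto_nhdsWithin_iff.2 ⟨?_, ?_⟩)
    · have : Tendsto (fun t : ℝ => T - t) (nhds T) (nhds (T - T)) :=
        (continuous_const.sub continuous_id).tendsto T
      rw [sub_self] at this
      exact this.mono_left nhdsWithin_le_nhds
    · filter_upwards [self_mem_nhdsWithin] with t ht
      simpa using ht
  have hr : Tendsto (fun t : ℝ => Real.log T / Real.log (T - t)) (nhdsWithin T (Iio T))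
      (nhds 0) := tendsto_const_nhds.div_atBot hlog
  set F : ℝ → ℝ → ℝ := fun t v =>
    ∫ x in ((T - t) * Real.exp (-(Real.log (T - t) * v)))..
      (T * Real.exp (-(Real.log (T - t) * v))), κ x with hF
  have hFsub : ∀ t v, F t v = (∫ x in (0 : ℝ)..(T * Real.exp (-(Real.log (T - t) * v))), κ x) -
      ∫ x in (0 : ℝ)..((T - t) * Real.exp (-(Real.log (T - t) * v))), κ x := fun t v =>
    (intervalIntegral.integral_interval_sub_left hκ.intervalIntegrable
        hκ.intervalIntegrable).symm
  have hFc : ∀ t, Continuous (F t) := by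
    intro t
    rw [show F t = _ from funext (hFsub t)]
    exact (hP.comp (by fun_prop)).sub (hP.comp (by fun_prop))
  have hmain : Tendsto (fun t => ∫ v in (0 : ℝ)..1, F t v) (nhdsWithin T (Iio T))
      (nhds (∫ _ in (0 : ℝ)..1, ∫ x in Ioi 0, κ x)) := by
    refine intervalIntegral.tendsto_integral_filter_of_dominated_convergence (fun _ => M)
      (Eventually.of_forall fun t => (hFc t).aestronglyMeasurable)
      (Eventually.of_forall fun t => Eventually.of_forall fun v _ => hM _ _)
      intervalIntegrable_const ?_
    filter_upwards [compl_mem_ae_iff.2 (measure_singleton (1 : ℝ))] with v hv1 hv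
    rw [uIoc_of_le zero_le_one] at hv
    have hv1 : v < 1 := lt_of_le_of_ne hv.2 hv1
    simp only [hFsub]
    rw [← sub_zero (∫ x in Ioi 0, κ x)]
    refine Tendsto.sub ?_ ?_
    · refine intervalIntegral_tendsto_integral_Ioi 0 hκ.integrableOn ?_
      refine Tendsto.const_mul_atTop hT (Real.tendsto_exp_atTop.comp ?_)
      exact tendsto_neg_atBot_atTop.comp (hlog.atBot_mul_const hv.1)
    · have : Tendsto (fun t : ℝ => (T - t) * Real.exp (-(Real.log (T - t) * v)))
          (nhdsWithin T (Iio T)) (nhds 0) := by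
        have h1 : Tendsto (fun t : ℝ => Real.exp (Real.log (T - t) * (1 - v)))
            (nhdsWithin T (Iio T)) (nhds 0) :=
          Real.tendsto_exp_atBot.comp (hlog.atBot_mul_const (by linarith))
        refine h1.congr' ?_
        filter_upwards [self_mem_nhdsWithin] with t ht
        have : 0 < T - t := by simpa using ht
        nth_rw 2 [← Real.exp_log this]
        rw [← Real.exp_add]
        ring_nf
      simpa [Function.comp_def] using (hP.tendsto 0).comp this
  have herr : Tendsto (fun t => ∫ v in (0 : ℝ)..(Real.log T / Real.log (T - t)), F t v)
      (nhdsWithin T (Iio T)) (nhds 0) := by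
    refine squeeze_zero_norm (a := fun t => M * |Real.log T / Real.log (T - t) - 0|)
      (fun t => intervalIntegral.norm_integral_le_of_norm_le_const fun v _ => hM _ _) ?_
    simpa using hr.abs.const_mul M
  have := hmain.sub herr
  simp only [intervalIntegral.integral_const, sub_zero, one_smul] at this
  refine this.congr' ?_
  filter_upwards [self_mem_nhdsWithin, hlog.eventually_lt_atBot 0,
    mem_nhdsWithin_of_mem_nhds (Ioi_mem_nhds hT)] with t ht hl ht0
  rw [integral_inv_mul_intervalIntegral_div hκ ht0 ht,
    intervalIntegral.integral_interval_sub_left ((hFc t).intervalIntegrable _ _)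
      ((hFc t).intervalIntegrable _ _)]
  have h := intervalIntegral.smul_integral_comp_mul_left (a := 1)
    (b := Real.log T / Real.log (T - t))
    (fun w => ∫ x in ((T - t) * Real.exp (-w))..(T * Real.exp (-w)), κ x) (Real.log (T - t))
  rw [mul_one, mul_div_cancel₀ _ hl.ne] at h
  rw [← h, intervalIntegral.integral_symm, abs_of_neg hl, smul_eq_mul]
  have := hl.ne
  field_simp
  rfl

lemma integrableOn_betaIntegrand {a b : ℝ} (ha : 0 < a) (hb : 0 < b) :
    IntegrableOn (fun x : ℝ => x ^ (a - 1) * (1 - x) ^ (b - 1)) (Ioo 0 1) := by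
  have h := Complex.betaIntegral_convergent (u := a) (v := b) (by simpa) (by simpa)
  rw [intervalIntegrable_iff_integrableOn_Ioo_of_le zero_le_one] at h
  refine IntegrableOn.congr_fun h.norm (fun x hx => ?_) measurableSet_Ioo
  have h1 : 0 < 1 - x := by linarith [hx.2]
  have e : (1 - (x : ℂ)) = ((1 - x : ℝ) : ℂ) := by push_cast; rfl
  simp only [norm_mul]
  rw [e, Complex.norm_cpow_eq_rpow_re_of_pos hx.1, Complex.norm_cpow_eq_rpow_re_of_pos h1]
  simp

lemma image_inv_Ioo_zero_one : (fun x : ℝ => x⁻¹) '' Ioo 0 1 = Ioi 1 := by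
  rw [show (fun x : ℝ => x⁻¹) = Inv.inv from rfl, image_inv_eq_inv, inv_Ioo_0_left one_pos,
    inv_one]

/-- The function `x ^ (-H) |1 - x| ^ (2H - 2)` is invariant under the inversion `x ↦ x⁻¹`. -/
lemma abs_deriv_inv_smul_kernel (H : ℝ) {x : ℝ} (hx : x ∈ Ioo (0 : ℝ) 1) :
    |-(x ^ 2)⁻¹| • (x⁻¹ ^ (-H) * |1 - x⁻¹| ^ (2 * H - 2)) =
      x ^ (-H) * |1 - x| ^ (2 * H - 2) := by
  have hx0 := hx.1
  have h1 : 0 < 1 - x := by linarith [hx.2]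
  have e : |1 - x⁻¹| = (1 - x) * x⁻¹ := by
    rw [abs_of_nonpos (by linarith [(one_lt_inv₀ hx0).2 hx.2])]
    field_simp
    ring
  rw [e, abs_neg, abs_of_pos (by positivity), abs_of_pos h1, Real.mul_rpow h1.le (by positivity),
    Real.inv_rpow hx0.le, Real.inv_rpow hx0.le, ← Real.rpow_neg hx0.le, ← Real.rpow_neg hx0.le,
    ← Real.rpow_natCast, ← Real.rpow_neg hx0.le, smul_eq_mul]
  have : x ^ (-H) = x ^ (-((2 : ℕ) : ℝ)) * x ^ (- -H) * x ^ (-(2 * H - 2)) := by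
    rw [← Real.rpow_add hx0, ← Real.rpow_add hx0]
    congr 1
    push_cast
    ring
  rw [this]
  ring

lemma kernel_eq_betaIntegrand (H : ℝ) {x : ℝ} (hx : x ∈ Ioo (0 : ℝ) 1) :
    x ^ (1 - H - 1) * (1 - x) ^ (2 * H - 1 - 1) = x ^ (-H) * |1 - x| ^ (2 * H - 2) := by
  rw [abs_of_pos (by linarith [hx.2])]
  ring_nf

lemma integrableOn_kernel_and_integral_eq {H : ℝ} (hH : 1 / 2 < H) (hH1 : H < 1) :
    IntegrableOn (fun x : ℝ => x ^ (-H) * |1 - x| ^ (2 * H - 2)) (Ioi 0) ∧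
    ∫ x in Ioi (0 : ℝ), x ^ (-H) * |1 - x| ^ (2 * H - 2) =
      2 * ∫ x in Ioo (0 : ℝ) 1, x ^ (1 - H - 1) * (1 - x) ^ (2 * H - 1 - 1) := by
  set k : ℝ → ℝ := fun x => x ^ (-H) * |1 - x| ^ (2 * H - 2)
  have h0 : IntegrableOn k (Ioo 0 1) :=
    (integrableOn_betaIntegrand (a := 1 - H) (b := 2 * H - 1) (by linarith)
      (by linarith)).congr_fun (fun x hx => kernel_eq_betaIntegrand H hx) measurableSet_Ioo
  have hderiv : ∀ x ∈ Ioo (0 : ℝ) 1,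
      HasDerivWithinAt (fun x : ℝ => x⁻¹) (-(x ^ 2)⁻¹) (Ioo 0 1) x := fun x hx =>
    (hasDerivAt_inv hx.1.ne').hasDerivWithinAt
  have hcongr : EqOn (fun x => |-(x ^ 2)⁻¹| • k x⁻¹) k (Ioo 0 1) := fun x hx =>
    abs_deriv_inv_smul_kernel H hx
  have h1 : IntegrableOn k (Ioi 1) := by
    rw [← image_inv_Ioo_zero_one, integrableOn_image_iff_integrableOn_abs_deriv_smul
      measurableSet_Ioo hderiv inv_injective.injOn]
    exact h0.congr_fun hcongr.symm measurableSet_Ioo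
  have e1 : ∫ x in Ioi 1, k x = ∫ x in Ioo 0 1, k x := by
    rw [← image_inv_Ioo_zero_one, integral_image_eq_integral_abs_deriv_smul
      measurableSet_Ioo hderiv inv_injective.injOn]
    exact setIntegral_congr_fun measurableSet_Ioo hcongr
  have h0' : IntegrableOn k (Ioc 0 1) := (integrableOn_Ioc_iff_integrableOn_Ioo (by simp)).2 h0
  have hU : Ioc (0 : ℝ) 1 ∪ Ioi 1 = Ioi 0 := Ioc_union_Ioi_eq_Ioi zero_le_one
  refine ⟨hU ▸ h0'.union h1, ?_⟩
  rw [← hU, setIntegral_union (Ioc_disjoint_Ioi le_rfl) measurableSet_Ioi h0' h1, e1,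
    integral_Ioc_eq_integral_Ioo, ← two_mul]
  congr 1
  exact setIntegral_congr_fun measurableSet_Ioo fun x hx => (kernel_eq_betaIntegrand H hx).symm

/-- Homogeneity of the kernel: the substitution `u = T - (T - s) x` in the inner integral. -/
lemma integral_rpow_mul_abs_sub_rpow (H : ℝ) {s t T : ℝ} (hst : s ≤ t) (ht : 0 ≤ t)
    (htT : t < T) :
    ∫ u in Ioo (0 : ℝ) t, (T - s) ^ (-H) * (T - u) ^ (-H) * |s - u| ^ (2 * H - 2) =
      (T - s)⁻¹ * ∫ x in ((T - t) / (T - s))..(T / (T - s)),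
        (Ioi 0).indicator (fun x => x ^ (-H) * |1 - x| ^ (2 * H - 2)) x := by
  have hs : 0 < T - s := by linarith
  have h := intervalIntegral.smul_integral_comp_sub_mul (a := (T - t) / (T - s))
    (b := T / (T - s))
    (fun u => (T - s) ^ (-H) * (T - u) ^ (-H) * |s - u| ^ (2 * H - 2)) (T - s) T
  rw [mul_div_cancel₀ _ hs.ne', mul_div_cancel₀ _ hs.ne', sub_self, sub_sub_cancel] at h
  rw [← integral_Ioc_eq_integral_Ioo, ← intervalIntegral.integral_of_le ht, ← h, smul_eq_mul,
    ← intervalIntegral.integral_const_mul, ← intervalIntegral.integral_const_mul]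
  refine intervalIntegral.integral_congr fun x hx => ?_
  rw [uIcc_of_le (by gcongr; linarith)] at hx
  have hx0 : 0 < x := lt_of_lt_of_le (div_pos (by linarith) hs) hx.1
  have e : |s - (T - (T - s) * x)| = (T - s) * |1 - x| := by
    rw [show s - (T - (T - s) * x) = (T - s) * -(1 - x) by ring, abs_mul, abs_neg, abs_of_pos hs]
  simp only [indicator_of_mem (mem_Ioi.2 hx0)]
  rw [e, sub_sub_cancel, Real.mul_rpow hs.le hx0.le, Real.mul_rpow hs.le (abs_nonneg _)]
  have : (T - s)⁻¹ = (T - s) * ((T - s) ^ (-H) * (T - s) ^ (-H) * (T - s) ^ (2 * H - 2)) := by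
    rw [← Real.rpow_add hs, ← Real.rpow_add hs, ← Real.rpow_neg_one]
    nth_rw 2 [← Real.rpow_one (T - s)]
    rw [← Real.rpow_add hs]
    congr 1
    ring
  rw [this]
  ring

theorem stmt11 (H T : ℝ) (hH : 1/2 < H) (hH1 : H < 1)
    (hT : 0 < T) (hT1 : T ≤ 1) :
    Filter.Tendsto (fun t : ℝ =>
      (1 / |Real.log (T - t)|) * ∫ s in Set.Ioo (0:ℝ) t, ∫ u in Set.Ioo (0:ℝ) t,
        (T - s) ^ (-H) * (T - u) ^ (-H) * |s - u| ^ (2*H - 2))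
      (nhdsWithin T (Set.Iio T))
      (nhds (2 * ∫ x in Set.Ioo (0:ℝ) 1,
        x ^ (1 - H - 1) * (1 - x) ^ (2*H - 1 - 1))) := by
  obtain ⟨hint, heq⟩ := integrableOn_kernel_and_integral_eq hH hH1
  have h := tendsto_inv_abs_log_mul_integral (hint.integrable_indicator measurableSet_Ioi) hT
  rw [setIntegral_indicator measurableSet_Ioi, inter_self, heq] at h
  refine h.congr' ?_
  filter_upwards [self_mem_nhdsWithin, mem_nhdsWithin_of_mem_nhds (Ioi_mem_nhds hT)]
    with t htT ht0
  rw [intervalIntegral.integral_of_le (le_of_lt ht0), integral_Ioc_eq_integral_Ioo]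
  congr 1
  exact setIntegral_congr_fun measurableSet_Ioo fun s hs =>
    (integral_rpow_mul_abs_sub_rpow H hs.2.le (le_of_lt ht0) htT).symm
end
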